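/- arXiv:0908.3528 — 3 statements merged into one kernel-verified Lean document; each statement's English description precedes it below -/
import Mathlib

section
/- For n ≥ 100 and 12 ≤ m ≤ n/2 + 1, the sum ∑_{k ≤ m-1} C(n,k) (m/n)^k (1 - m/n)^{n-k} is at least 3/8. -/
/-- The binomial lower tail `P(Bin(n,x) ≤ k)`. -/
noncomputable def tailS3 (n k : ℕ) (x : ℝ) : ℝ :=
  ∑ i ∈ Finset.range (k + 1), (n.choose i : ℝ) * x ^ i * (1 - x) ^ (n - i)

theorem tailS3_hasDerivAt (n k : ℕ) (x : ℝ) :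
    HasDerivAt (tailS3 n k)
      (-((n : ℝ) * (((n - 1).choose k : ℝ) * x ^ k * (1 - x) ^ (n - 1 - k)))) x := by
  have hfun : tailS3 n k = fun x => Polynomial.eval x
      (∑ i ∈ Finset.range (k + 1), bernsteinPolynomial ℝ n i) := by
    funext y
    simp [tailS3, Polynomial.eval_finsetSum, bernsteinPolynomial]
  have hder : Polynomial.derivative (∑ i ∈ Finset.range (k + 1), bernsteinPolynomial ℝ n i)
      = -(n * bernsteinPolynomial ℝ (n - 1) k) := by
    induction k with
    | zero => simp [bernsteinPolynomial.derivative_zero]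
    | succ k ih =>
      rw [Finset.sum_range_succ, Polynomial.derivative_add, ih (by
        funext y
        simp [tailS3, Polynomial.eval_finsetSum, bernsteinPolynomial]),
        bernsteinPolynomial.derivative_succ]
      ring
  rw [hfun]
  have h := Polynomial.hasDerivAt (∑ i ∈ Finset.range (k + 1), bernsteinPolynomial ℝ n i) x
  rw [hder] at h
  refine h.congr_deriv ?_
  simp [bernsteinPolynomial]

theorem tailS3_zero (n k : ℕ) : tailS3 n k 0 = 1 := by
  unfold tailS3
  rw [Finset.sum_eq_single 0]
  · simp
  · intro b _ hb
    simp [hb]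
  · simp

theorem tailS3_nonneg (n k : ℕ) (x : ℝ) (h0 : 0 ≤ x) (h1 : x ≤ 1) : 0 ≤ tailS3 n k x := by
  unfold tailS3
  apply Finset.sum_nonneg
  intro i _
  have : 0 ≤ 1 - x := by linarith
  positivity

/-- Reflection argument for the median. -/
theorem half_le_tailS3 (n k : ℕ) (p : ℝ) (hp0 : 0 < p) (hp : p ≤ 1 / 2)
    (hg : ∀ s, 0 < s → s < p →
      (p - s) ^ k * (1 - (p - s)) ^ (n - 1 - k) ≤ (p + s) ^ k * (1 - (p + s)) ^ (n - 1 - k)) :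
    1 / 2 ≤ tailS3 n k p := by
  have hd : ∀ s : ℝ, HasDerivAt (fun s => tailS3 n k (p - s) + tailS3 n k (p + s))
      ((n : ℝ) * ((n - 1).choose k : ℝ) * ((p - s) ^ k * (1 - (p - s)) ^ (n - 1 - k)
        - (p + s) ^ k * (1 - (p + s)) ^ (n - 1 - k))) s := by
    intro s
    have h1 := (tailS3_hasDerivAt n k (p - s)).comp s ((hasDerivAt_id s).const_sub p)
    have h2 := (tailS3_hasDerivAt n k (p + s)).comp s ((hasDerivAt_id s).const_add p)
    refine (h1.add h2).congr_deriv ?_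
    ring
  have hanti : AntitoneOn (fun s => tailS3 n k (p - s) + tailS3 n k (p + s)) (Set.Icc 0 p) := by
    apply antitoneOn_of_deriv_nonpos (convex_Icc 0 p)
    · exact fun s _ => (hd s).continuousAt.continuousWithinAt
    · exact fun s _ => (hd s).differentiableAt.differentiableWithinAt
    · intro s hs
      rw [interior_Icc] at hs
      rw [(hd s).deriv]
      have := hg s hs.1 hs.2
      apply mul_nonpos_of_nonneg_of_nonpos (by positivity)
      linarith
  have h := hanti (Set.left_mem_Icc.2 hp0.le) (Set.right_mem_Icc.2 hp0.le) hp0.le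
  simp only [sub_self, sub_zero, add_zero, tailS3_zero] at h
  have := tailS3_nonneg n k (p + p) (by linarith) (by linarith)
  linarith

theorem log_compare (p q s : ℝ) (hs : 0 < s) (hsp : s < p) (hpq : p ≤ q) :
    q * (Real.log (q + s) - Real.log (q - s)) ≤ p * (Real.log (p + s) - Real.log (p - s)) := by
  have key : ∀ t : ℝ, s < t → HasSum (fun k : ℕ => t * ((2 : ℝ) * (1 / (2 * k + 1))
      * (s / t) ^ (2 * k + 1))) (t * (Real.log (t + s) - Real.log (t - s))) := by
    intro t ht
    have ht0 : 0 < t := by linarith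
    have h1 : |s / t| < 1 := by
      rw [abs_of_pos (by positivity), div_lt_one ht0]; exact ht
    have h2 := (Real.hasSum_log_sub_log_of_abs_lt_one h1).mul_left t
    have e1 : 1 + s / t = (t + s) / t := by field_simp
    have e2 : 1 - s / t = (t - s) / t := by field_simp
    have e3 : Real.log (1 + s / t) - Real.log (1 - s / t) = Real.log (t + s) - Real.log (t - s) := by
      rw [e1, e2, Real.log_div (by linarith) ht0.ne', Real.log_div (by linarith) ht0.ne']
      ring
    rw [e3] at h2
    exact h2
  refine hasSum_le ?_ (key q (by linarith)) (key p hsp)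
  intro k
  have hp0 : 0 < p := by linarith
  have hq0 : 0 < q := by linarith
  have e : ∀ t : ℝ, 0 < t → t * ((2 : ℝ) * (1 / (2 * k + 1)) * (s / t) ^ (2 * k + 1))
      = 2 * (1 / (2 * k + 1)) * s * (s / t) ^ (2 * k) := by
    intro t ht
    rw [pow_succ]
    field_simp
  simp only [e p hp0, e q hq0]
  gcongr

theorem median_ineq (n m : ℕ) (hm : 0 < m) (hmn : 2 * m ≤ n) (s : ℝ) (hs : 0 < s)
    (hsp : s < (m : ℝ) / n) :
    ((m : ℝ) / n - s) ^ m * (1 - ((m : ℝ) / n - s)) ^ (n - 1 - m) ≤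
      ((m : ℝ) / n + s) ^ m * (1 - ((m : ℝ) / n + s)) ^ (n - 1 - m) := by
  have hn0 : (0 : ℝ) < n := by
    have : 0 < n := by omega
    exact_mod_cast this
  have hmn' : (2 : ℝ) * m ≤ n := by exact_mod_cast hmn
  set p : ℝ := (m : ℝ) / n with hp
  have hpn : p * n = m := by rw [hp]; field_simp
  have hp2 : p ≤ 1 / 2 := by
    rw [hp, div_le_iff₀ hn0]; linarith
  obtain ⟨r, hr⟩ : ∃ r, n = m + r + 1 := ⟨n - 1 - m, by omega⟩
  have hrr : n - 1 - m = r := by omega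
  rw [hrr]
  have hc := log_compare p (1 - p) s hs hsp (by linarith)
  have hrn : (r : ℝ) ≤ n * (1 - p) := by
    have : (n : ℝ) = m + r + 1 := by exact_mod_cast hr
    nlinarith
  have hlogpos : 0 ≤ Real.log (1 - p + s) - Real.log (1 - p - s) := by
    have := Real.log_le_log (show 0 < 1 - p - s by linarith) (show 1 - p - s ≤ 1 - p + s by linarith)
    linarith
  have hmain : (r : ℝ) * (Real.log (1 - p + s) - Real.log (1 - p - s)) ≤
      m * (Real.log (p + s) - Real.log (p - s)) := by
    calc (r : ℝ) * (Real.log (1 - p + s) - Real.log (1 - p - s))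
        ≤ n * (1 - p) * (Real.log (1 - p + s) - Real.log (1 - p - s)) := by gcongr
      _ = n * ((1 - p) * (Real.log (1 - p + s) - Real.log (1 - p - s))) := by ring
      _ ≤ n * (p * (Real.log (p + s) - Real.log (p - s))) := by gcongr
      _ = m * (Real.log (p + s) - Real.log (p - s)) := by rw [← hpn]; ring
  have e1 : 1 - (p - s) = 1 - p + s := by ring
  have e2 : 1 - (p + s) = 1 - p - s := by ring
  rw [e1, e2]
  have a1 : 0 < p - s := by linarith
  have a2 : 0 < p + s := by linarith
  have a3 : 0 < 1 - p - s := by linarith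
  have a4 : 0 < 1 - p + s := by linarith
  rw [← Real.log_le_log_iff (by positivity) (by positivity),
    Real.log_mul (by positivity) (by positivity), Real.log_mul (by positivity) (by positivity)]
  simp only [Real.log_pow]
  linarith

/-- `A k = k^k / k!`. -/
noncomputable def AS3 (k : ℕ) : ℝ := (k : ℝ) ^ k / (k.factorial : ℝ)

theorem AS3_pos (k : ℕ) : 0 < AS3 k := by
  unfold AS3
  rcases Nat.eq_zero_or_pos k with h | h
  · subst h; simp
  · positivity

theorem AS3_logconvex (k : ℕ) : AS3 (k + 1) / AS3 k ≤ AS3 (k + 2) / AS3 (k + 1) := by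
  rw [div_le_div_iff₀ (AS3_pos _) (AS3_pos _)]
  have key : ((k : ℝ) + 1) ^ (2 * k + 1) ≤ (k : ℝ) ^ k * ((k : ℝ) + 2) ^ (k + 1) := by
    have hb := one_add_mul_le_pow (a := -(1 / ((k : ℝ) + 1) ^ 2)) (by
      have : 1 / ((k : ℝ) + 1) ^ 2 ≤ 1 := by
        rw [div_le_one (by positivity)]
        nlinarith [(Nat.cast_nonneg k : (0 : ℝ) ≤ k)]
      linarith) k
    have e : 1 + -(1 / ((k : ℝ) + 1) ^ 2) = (k * (k + 2)) / ((k : ℝ) + 1) ^ 2 := by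
      field_simp; ring
    rw [e, div_pow, le_div_iff₀ (by positivity), mul_pow, ← pow_mul] at hb
    have h2 : ((k : ℝ) + 1) ≤ (1 + k * -(1 / ((k : ℝ) + 1) ^ 2)) * (k + 2) := by
      have : (1 + k * -(1 / ((k : ℝ) + 1) ^ 2)) * (k + 2) - (k + 1) = 1 / ((k : ℝ) + 1) ^ 2 := by
        field_simp; ring
      have : 0 < 1 / ((k : ℝ) + 1) ^ 2 := by positivity
      linarith
    calc ((k : ℝ) + 1) ^ (2 * k + 1) = (k + 1) * ((k : ℝ) + 1) ^ (2 * k) := by ring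
      _ ≤ ((1 + k * -(1 / ((k : ℝ) + 1) ^ 2)) * (k + 2)) * ((k : ℝ) + 1) ^ (2 * k) := by gcongr
      _ = ((1 + k * -(1 / ((k : ℝ) + 1) ^ 2)) * ((k : ℝ) + 1) ^ (2 * k)) * (k + 2) := by ring
      _ ≤ (k : ℝ) ^ k * (k + 2) ^ k * (k + 2) := by gcongr
      _ = _ := by ring
  have f1 : AS3 (k + 1) = ((k : ℝ) + 1) ^ k / k.factorial := by
    unfold AS3
    rw [Nat.factorial_succ]; push_cast
    have : (k.factorial : ℝ) ≠ 0 := by positivity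
    field_simp
    ring
  have f2 : AS3 (k + 2) = ((k : ℝ) + 2) ^ (k + 1) / ((k + 1) * k.factorial) := by
    unfold AS3
    rw [Nat.factorial_succ, Nat.factorial_succ]; push_cast
    have : (k.factorial : ℝ) ≠ 0 := by positivity
    field_simp
    ring
  rw [f1, f2]
  unfold AS3
  have hf : (0 : ℝ) < k.factorial := by positivity
  have l : ((k : ℝ) + 1) ^ k / k.factorial * (((k : ℝ) + 1) ^ k / k.factorial)
      = ((k : ℝ) + 1) ^ (2 * k + 1) / ((k + 1) * k.factorial * k.factorial) := by
    field_simp; ring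
  have r : ((k : ℝ) + 2) ^ (k + 1) / ((k + 1) * k.factorial) * ((k : ℝ) ^ k / k.factorial)
      = ((k : ℝ) ^ k * ((k : ℝ) + 2) ^ (k + 1)) / ((k + 1) * k.factorial * k.factorial) := by
    field_simp
  rw [l, r]
  gcongr

theorem AS3_ratio_mono : Monotone (fun k => AS3 (k + 1) / AS3 k) :=
  monotone_nat_of_le_succ AS3_logconvex

noncomputable def hS3 (m r : ℕ) : ℝ := AS3 m * AS3 r / AS3 (m + r)

theorem hS3_comm (m r : ℕ) : hS3 m r = hS3 r m := by
  unfold hS3; rw [add_comm, mul_comm]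

theorem hS3_anti (m : ℕ) : Antitone (hS3 m) := by
  apply antitone_nat_of_succ_le
  intro r
  have h := AS3_ratio_mono (Nat.le_add_left r m)
  simp only at h
  unfold hS3
  rw [div_le_div_iff₀ (AS3_pos _) (AS3_pos _)] at h ⊢
  have := mul_le_mul_of_nonneg_left h (AS3_pos m).le
  rw [← add_assoc]
  linarith

theorem hS3_le {a b m r : ℕ} (ha : a ≤ m) (hb : b ≤ r) : hS3 m r ≤ hS3 a b := by
  calc hS3 m r ≤ hS3 m b := hS3_anti m hb
    _ = hS3 b m := hS3_comm _ _
    _ ≤ hS3 b a := hS3_anti b ha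
    _ = hS3 a b := hS3_comm _ _

theorem hS3_eq (m r : ℕ) (h : 0 < m + r) :
    hS3 m r = ((m + r).choose m : ℝ) * ((m : ℝ) / (m + r)) ^ m * ((r : ℝ) / (m + r)) ^ r := by
  have h0 : (0 : ℝ) < m + r := by exact_mod_cast h
  unfold hS3 AS3
  rw [Nat.cast_add_choose]
  have h1 : (m.factorial : ℝ) ≠ 0 := by positivity
  have h2 : (r.factorial : ℝ) ≠ 0 := by positivity
  have h3 : ((m + r).factorial : ℝ) ≠ 0 := by positivity
  push_cast
  rw [div_pow, div_pow, pow_add]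
  field_simp

theorem hS3_12_88 : hS3 12 88 ≤ 1 / 8 := by
  rw [hS3_eq _ _ (by norm_num)]
  have : (12 + 88).choose 12 = 1050421051106700 := by
    rw [Nat.choose_eq_factorial_div_factorial (by norm_num)]; norm_num [Nat.factorial]
  rw [this]; norm_num

theorem hS3_13_50 : hS3 13 50 ≤ 1 / 8 := by
  rw [hS3_eq _ _ (by norm_num)]
  have : (13 + 50).choose 13 = 10468434365991 := by
    rw [Nat.choose_eq_factorial_div_factorial (by norm_num)]; norm_num [Nat.factorial]
  rw [this]; norm_num

theorem hS3_50_50 : hS3 50 50 ≤ 1 / 12 := by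
  rw [hS3_eq _ _ (by norm_num)]
  have : (50 + 50).choose 50 = 100891344545564193334812497256 := by
    rw [Nat.choose_eq_factorial_div_factorial (by norm_num)]; norm_num [Nat.factorial]
  rw [this]; norm_num

theorem hS3_diag (j : ℕ) (hj : 50 ≤ j) : ((2 * j).choose j : ℝ) * (1 / 4) ^ j ≤ 1 / 12 := by
  have h := (hS3_le hj hj).trans hS3_50_50
  rw [hS3_eq _ _ (by omega)] at h
  have hj0 : (0 : ℝ) < j := by
    have : 0 < j := by omega
    exact_mod_cast this
  have e : (j : ℝ) / (j + j) = 1 / 2 := by field_simp; norm_num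
  rw [e, mul_assoc, ← mul_pow, ← two_mul] at h
  norm_num at h ⊢
  exact h

theorem half_le_sym (n j : ℕ) (h : n - 1 - j ≤ j) : 1 / 2 ≤ tailS3 n j (1 / 2) := by
  apply half_le_tailS3 _ _ _ (by norm_num) le_rfl
  intro s hs hs2
  obtain ⟨d, hd⟩ := Nat.exists_eq_add_of_le h
  set r := n - 1 - j
  rw [hd]
  have e1 : 1 - (1 / 2 - s) = 1 / 2 + s := by ring
  have e2 : 1 - (1 / 2 + s) = 1 / 2 - s := by ring
  rw [e1, e2]
  have a : 0 < 1 / 2 - s := by linarith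
  calc (1 / 2 - s) ^ (r + d) * (1 / 2 + s) ^ r
      = ((1 / 2 - s) ^ r * (1 / 2 + s) ^ r) * (1 / 2 - s) ^ d := by ring
    _ ≤ ((1 / 2 - s) ^ r * (1 / 2 + s) ^ r) * (1 / 2 + s) ^ d := by
        gcongr
        linarith
    _ = _ := by ring

/-- mean value bound -/
theorem tailS3_mvt (n k : ℕ) (p K : ℝ) (hp : 1 / 2 < p)
    (hK : ∀ t, 1 / 2 < t → t < p →
      (n : ℝ) * (((n - 1).choose k : ℝ) * t ^ k * (1 - t) ^ (n - 1 - k)) ≤ K) :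
    tailS3 n k (1 / 2) - K * (p - 1 / 2) ≤ tailS3 n k p := by
  obtain ⟨c, hc, he⟩ := exists_hasDerivAt_eq_slope (tailS3 n k) _ hp
    (fun x _ => (tailS3_hasDerivAt n k x).continuousAt.continuousWithinAt)
    (fun x _ => tailS3_hasDerivAt n k x)
  have h := hK c hc.1 hc.2
  have hp' : 0 < p - 1 / 2 := by linarith
  rw [eq_div_iff hp'.ne'] at he
  nlinarith

theorem quarter (t : ℝ) : t * (1 - t) ≤ 1 / 4 := by nlinarith [sq_nonneg (t - 1 / 2)]

theorem case_odd (j : ℕ) (hj : 50 ≤ j) :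
    3 / 8 ≤ tailS3 (2 * j + 1) j (((j + 1 : ℕ) : ℝ) / ((2 * j + 1 : ℕ) : ℝ)) := by
  have hj0 : (50 : ℝ) ≤ j := by exact_mod_cast hj
  have hd := hS3_diag j hj
  have hpe : ((j + 1 : ℕ) : ℝ) / ((2 * j + 1 : ℕ) : ℝ) - 1 / 2 = 1 / (2 * ((2 * j + 1 : ℕ) : ℝ)) := by
    push_cast; field_simp; ring
  have hpos : (0 : ℝ) < 1 / (2 * ((2 * j + 1 : ℕ) : ℝ)) := by positivity
  have hp1 : ((j + 1 : ℕ) : ℝ) / ((2 * j + 1 : ℕ) : ℝ) ≤ 1 := by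
    rw [div_le_one (by positivity)]; push_cast; linarith
  have h := tailS3_mvt (2 * j + 1) j _ (((2 * j + 1 : ℕ) : ℝ) * (1 / 12))
    (show 1 / 2 < ((j + 1 : ℕ) : ℝ) / ((2 * j + 1 : ℕ) : ℝ) by linarith) (by
      intro t ht1 ht2
      have e1 : 2 * j + 1 - 1 = 2 * j := by omega
      have e2 : 2 * j - j = j := by omega
      rw [e1, e2]
      have ht : 0 ≤ 1 - t := by linarith
      have ht0 : 0 ≤ t := by linarith
      have : ((2 * j).choose j : ℝ) * t ^ j * (1 - t) ^ j ≤ 1 / 12 := by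
        rw [mul_assoc, ← mul_pow]
        refine le_trans ?_ hd
        gcongr
        exact quarter t
      gcongr)
  rw [hpe] at h
  have e3 : ((2 * j + 1 : ℕ) : ℝ) * (1 / 12) * (1 / (2 * ((2 * j + 1 : ℕ) : ℝ))) = 1 / 24 := by
    field_simp; norm_num
  rw [e3] at h
  have := half_le_sym (2 * j + 1) j (by omega)
  linarith

theorem case_even (i : ℕ) (hj : 50 ≤ i + 1) :
    3 / 8 ≤ tailS3 (2 * (i + 1)) (i + 1) (((i + 2 : ℕ) : ℝ) / ((2 * (i + 1) : ℕ) : ℝ)) := by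
  have hj0 : (49 : ℝ) ≤ i := by
    have : 49 ≤ i := by omega
    exact_mod_cast this
  have hd := hS3_diag (i + 1) hj
  have hpe : ((i + 2 : ℕ) : ℝ) / ((2 * (i + 1) : ℕ) : ℝ) - 1 / 2 = 1 / ((2 * (i + 1) : ℕ) : ℝ) := by
    push_cast; field_simp; ring
  have hpos : (0 : ℝ) < 1 / ((2 * (i + 1) : ℕ) : ℝ) := by positivity
  have hp1 : ((i + 2 : ℕ) : ℝ) / ((2 * (i + 1) : ℕ) : ℝ) ≤ 3 / 4 := by
    rw [div_le_iff₀ (by positivity)]; push_cast; linarith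
  have hch : ((2 * (i + 1)).choose (i + 1) : ℝ) = 2 * ((2 * i + 1).choose (i + 1) : ℝ) := by
    have h1 : (2 * (i + 1)).choose (i + 1) = (2 * i + 1).choose i + (2 * i + 1).choose (i + 1) :=
      Nat.choose_succ_succ (2 * i + 1) i
    have h2 := Nat.choose_symm_half i
    have : (2 * (i + 1)).choose (i + 1) = 2 * (2 * i + 1).choose (i + 1) := by omega
    exact_mod_cast this
  rw [hch, pow_succ] at hd
  have h := tailS3_mvt (2 * (i + 1)) (i + 1) _ (((2 * (i + 1) : ℕ) : ℝ) * (1 / 8))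
    (show 1 / 2 < ((i + 2 : ℕ) : ℝ) / ((2 * (i + 1) : ℕ) : ℝ) by linarith) (by
      intro t ht1 ht2
      have e1 : 2 * (i + 1) - 1 = 2 * i + 1 := by omega
      have e2 : 2 * i + 1 - (i + 1) = i := by omega
      rw [e1, e2]
      have ht : 0 ≤ 1 - t := by linarith
      have ht0 : 0 ≤ t := by linarith
      have ht3 : t ≤ 3 / 4 := by linarith
      have : ((2 * i + 1).choose (i + 1) : ℝ) * t ^ (i + 1) * (1 - t) ^ i ≤ 1 / 8 := by
        calc ((2 * i + 1).choose (i + 1) : ℝ) * t ^ (i + 1) * (1 - t) ^ i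
            = ((2 * i + 1).choose (i + 1) : ℝ) * (t * (1 - t)) ^ i * t := by
              rw [mul_pow]; ring
          _ ≤ ((2 * i + 1).choose (i + 1) : ℝ) * (1 / 4) ^ i * (3 / 4) := by
              gcongr
              exact quarter t
          _ ≤ 1 / 8 := by linarith
      gcongr)
  rw [hpe] at h
  have e3 : ((2 * (i + 1) : ℕ) : ℝ) * (1 / 8) * (1 / ((2 * (i + 1) : ℕ) : ℝ)) = 1 / 8 := by
    field_simp
  rw [e3] at h
  have := half_le_sym (2 * (i + 1)) (i + 1) (by omega)
  linarith

theorem case_main (n m : ℕ) (hn : 100 ≤ n) (hm : 12 ≤ m) (hmn : 2 * m ≤ n) :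
    (3 : ℝ) / 8 ≤
      ∑ k ∈ Finset.range m,
        (n.choose k : ℝ) * ((m : ℝ) / n) ^ k * (1 - (m : ℝ) / n) ^ (n - k) := by
  have hn0 : (0 : ℝ) < n := by
    have : 0 < n := by omega
    exact_mod_cast this
  have hm0 : (0 : ℝ) < m := by
    have : 0 < m := by omega
    exact_mod_cast this
  have hmn' : (2 : ℝ) * m ≤ n := by exact_mod_cast hmn
  have h := half_le_tailS3 n m ((m : ℝ) / n) (by positivity)
    (by rw [div_le_iff₀ hn0]; linarith)
    (fun s hs hsp => median_ineq n m (by omega) hmn s hs hsp)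
  unfold tailS3 at h
  rw [Finset.sum_range_succ] at h
  have hpm : (n.choose m : ℝ) * ((m : ℝ) / n) ^ m * (1 - (m : ℝ) / n) ^ (n - m) ≤ 1 / 8 := by
    obtain ⟨r, rfl⟩ : ∃ r, n = m + r := ⟨n - m, by omega⟩
    have e : 1 - (m : ℝ) / ((m + r : ℕ) : ℝ) = (r : ℝ) / (m + r) := by
      push_cast at hn0 ⊢
      field_simp; ring
    rw [e, Nat.add_sub_cancel_left, Nat.cast_add, ← hS3_eq _ _ (by omega)]
    by_cases hr : 88 ≤ r
    · exact (hS3_le hm hr).trans hS3_12_88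
    · exact (hS3_le (show 13 ≤ m by omega) (show 50 ≤ r by omega)).trans hS3_13_50
  linarith

theorem stmt3 (n m : ℕ) (hn : 100 ≤ n) (hm : 12 ≤ m) (hm' : (m : ℝ) ≤ (n : ℝ) / 2 + 1) :
    (3 : ℝ) / 8 ≤
      ∑ k ∈ Finset.range m,
        (n.choose k : ℝ) * ((m : ℝ) / n) ^ k * (1 - (m : ℝ) / n) ^ (n - k) := by
  have hm2 : 2 * m ≤ n + 2 := by
    have : (2 : ℝ) * m ≤ n + 2 := by linarith
    exact_mod_cast this
  by_cases hmn : 2 * m ≤ n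
  · exact case_main n m hn hm hmn
  · by_cases ho : n + 1 = 2 * m
    · obtain ⟨j, rfl⟩ : ∃ j, m = j + 1 := ⟨m - 1, by omega⟩
      obtain rfl : n = 2 * j + 1 := by omega
      exact case_odd j (by omega)
    · obtain ⟨i, rfl⟩ : ∃ i, m = i + 2 := ⟨m - 2, by omega⟩
      obtain rfl : n = 2 * (i + 1) := by omega
      exact case_even i (by omega)
end

section
/- For i.i.d. nonnegative-integer-valued random variables X_1,...,X_n each with mean 1, the minimum of P(X_1 + ... + X_n ≤ n) over all such distributions equals (1 - 1/(n+1))^n, attained by the distribution with P(X = n+1) = 1/(n+1) and P(X = 0) = 1 - 1/(n+1). -/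
/-- `p` is the mass function of a nonnegative-integer-valued random variable with mean 1. -/
def IsDist (p : ℕ → ℝ) : Prop :=
  (∀ j, 0 ≤ p j) ∧ HasSum p 1 ∧ HasSum (fun j : ℕ => (j : ℝ) * p j) 1

/-- Probability that the sum of `n` independent variables with mass functions `p i` is ≤ n. -/
noncomputable def probLe (n : ℕ) (p : Fin n → ℕ → ℝ) : ℝ :=
  ∑ f ∈ Finset.univ.filter (fun f : Fin n → Fin (n + 1) => (∑ i, (f i : ℕ)) ≤ n),
    ∏ i, p i (f i)


open Finset

/-- Probability that the downward skip-free walk started at height `x` hits `0` within `r` steps. -/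
noncomputable def hitLe (q : ℕ → ℝ) (M : ℕ) : ℕ → ℕ → ℝ
  | 0, x => if x = 0 then 1 else 0
  | _ + 1, 0 => 1
  | r + 1, x + 1 => ∑ k ∈ range M, q k * hitLe q M r (x + k)

/-- Probability that the walk started at `x` hits `0` exactly at step `m`. -/
noncomputable def hitEq (q : ℕ → ℝ) (M : ℕ) : ℕ → ℕ → ℝ
  | 0, x => if x = 0 then 1 else 0
  | _ + 1, 0 => 0
  | m + 1, x + 1 => ∑ k ∈ range M, q k * hitEq q M m (x + k)

/-- Probability that the walk started at `j` is `≤ 0` at step `r`. -/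
noncomputable def nonposAt (q : ℕ → ℝ) (M : ℕ) : ℕ → ℤ → ℝ
  | 0, j => if j ≤ 0 then 1 else 0
  | r + 1, j => ∑ k ∈ range M, q k * nonposAt q M r (j - 1 + k)

section walk

variable {q : ℕ → ℝ} {M : ℕ}

lemma hitLe_zero (r : ℕ) : hitLe q M r 0 = 1 := by
  cases r <;> simp [hitLe]

lemma hitLe_nonneg (hq : ∀ k, 0 ≤ q k) (r : ℕ) : ∀ x, 0 ≤ hitLe q M r x := by
  induction r with
  | zero => intro x; simp only [hitLe]; split_ifs <;> norm_num
  | succ r ih =>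
    intro x
    cases x with
    | zero => simp [hitLe]
    | succ x => exact sum_nonneg fun k _ => mul_nonneg (hq k) (ih _)

lemma hitLe_mono (hq : ∀ k, 0 ≤ q k) (r : ℕ) : ∀ x, hitLe q M r x ≤ hitLe q M (r + 1) x := by
  induction r with
  | zero =>
    intro x
    cases x with
    | zero => simp [hitLe]
    | succ x =>
      have := hitLe_nonneg (M := M) hq 1 (x + 1)
      simpa [hitLe] using this
  | succ r ih =>
    intro x
    cases x with
    | zero => simp [hitLe]
    | succ x =>
      exact sum_le_sum fun k _ => mul_le_mul_of_nonneg_left (ih _) (hq k)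

lemma hitLe_submul (hq : ∀ k, 0 ≤ q k) (r : ℕ) :
    ∀ x y, hitLe q M r (x + y) ≤ hitLe q M r x * hitLe q M r y := by
  induction r with
  | zero =>
    intro x y
    rcases Nat.eq_zero_or_pos x with rfl | hx
    · simp [hitLe]
    · have : x + y ≠ 0 := by omega
      have h2 : x ≠ 0 := by omega
      simp [hitLe, h2]
  | succ r ih =>
    intro x y
    cases x with
    | zero => simp [hitLe_zero]
    | succ x =>
      have e : x + 1 + y = (x + y) + 1 := by ring
      rw [e]
      calc hitLe q M (r + 1) (x + y + 1)
          = ∑ k ∈ range M, q k * hitLe q M r ((x + k) + y) := by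
            simp only [hitLe]
            exact sum_congr rfl fun k _ => by congr 2; ring
        _ ≤ ∑ k ∈ range M, q k * (hitLe q M r (x + k) * hitLe q M (r + 1) y) := by
            refine sum_le_sum fun k _ => mul_le_mul_of_nonneg_left ?_ (hq k)
            exact (ih _ _).trans
              (mul_le_mul_of_nonneg_left (hitLe_mono hq r y) (hitLe_nonneg hq r _))
        _ = hitLe q M (r + 1) (x + 1) * hitLe q M (r + 1) y := by
            simp only [hitLe, sum_mul]
            exact sum_congr rfl fun k _ => by ring

lemma hitLe_le_pow (hq : ∀ k, 0 ≤ q k) (r x : ℕ) : hitLe q M r x ≤ hitLe q M r 1 ^ x := by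
  induction x with
  | zero => simp [hitLe_zero]
  | succ x ih =>
    rw [pow_succ]
    exact (hitLe_submul hq r x 1).trans
      (mul_le_mul_of_nonneg_right ih (hitLe_nonneg hq r 1))

lemma hitLe_le_one (hq : ∀ k, 0 ≤ q k) (h1 : ∑ k ∈ range M, q k = 1) (r : ℕ) :
    ∀ x, hitLe q M r x ≤ 1 := by
  induction r with
  | zero => intro x; simp only [hitLe]; split_ifs <;> norm_num
  | succ r ih =>
    intro x
    cases x with
    | zero => simp [hitLe]
    | succ x =>
      calc hitLe q M (r + 1) (x + 1) ≤ ∑ k ∈ range M, q k * 1 :=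
            sum_le_sum fun k _ => mul_le_mul_of_nonneg_left (ih _) (hq k)
        _ = 1 := by simp [h1]

/-- The one-step hitting probability from height one dominates the averaged one. -/
lemma hitLe_one_le (hq : ∀ k, 0 ≤ q k) (r : ℕ) :
    hitLe q M r 1 ≤ ∑ k ∈ range M, q k * hitLe q M r k := by
  have h := hitLe_mono (M := M) hq r 1
  have e : hitLe q M (r + 1) 1 = ∑ k ∈ range M, q k * hitLe q M r k := by
    show hitLe q M (r + 1) (0 + 1) = _
    simp [hitLe]
  rwa [e] at h

lemma hitEq_nonneg (hq : ∀ k, 0 ≤ q k) (r : ℕ) : ∀ x, 0 ≤ hitEq q M r x := by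
  induction r with
  | zero => intro x; simp only [hitEq]; split_ifs <;> norm_num
  | succ r ih =>
    intro x
    cases x with
    | zero => simp [hitEq]
    | succ x => exact sum_nonneg fun k _ => mul_nonneg (hq k) (ih _)

lemma hitEq_eq_zero (m : ℕ) : ∀ x, m < x → hitEq q M m x = 0 := by
  induction m with
  | zero => intro x hx; simp [hitEq, hx.ne']
  | succ m ih =>
    intro x hx
    cases x with
    | zero => omega
    | succ x => exact sum_eq_zero fun k _ => by rw [ih _ (by omega), mul_zero]

/-- Convolution: to go down `x + y` levels, first go down `x`, then `y`. -/
lemma hitLe_conv (n : ℕ) : ∀ x y, hitLe q M n (x + y)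
    = ∑ m ∈ range (n + 1), hitEq q M m x * hitLe q M (n - m) y := by
  induction n with
  | zero =>
    intro x y
    by_cases hx : x = 0 <;> simp [hitLe, hitEq, hx]
  | succ n ih =>
    intro x y
    rw [sum_range_succ']
    cases x with
    | zero => simp [hitEq]
    | succ x =>
      have e : x + 1 + y = (x + y) + 1 := by ring
      rw [e]
      simp only [hitLe, hitEq]
      have : ∀ k, hitLe q M n (x + y + k)
          = ∑ m ∈ range (n + 1), hitEq q M m (x + k) * hitLe q M (n - m) y := fun k => by
        rw [← ih]; congr 1; ring
      simp only [this, mul_sum, sum_mul]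
      rw [sum_comm]
      simp only [Nat.add_sub_add_right, mul_assoc]
      simp

lemma hitLe_conv' (n x y : ℕ) (hx : x ≠ 0) : ∑ s ∈ range n,
    hitEq q M (s + 1) x * hitLe q M (n - s - 1) y = hitLe q M n (x + y) := by
  rw [hitLe_conv, sum_range_succ']
  simp [hitEq, hx, Nat.sub_sub]

lemma hitEq_one (hM : 0 < M) (z : ℕ) : hitEq q M 1 z = if z = 1 then q 0 else 0 := by
  cases z with
  | zero => simp [hitEq]
  | succ x =>
    show hitEq q M (0 + 1) (x + 1) = _
    simp only [hitEq]
    by_cases hx : x = 0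
    · subst hx
      rw [sum_eq_single 0] <;> simp +contextual [hM.ne']
    · simp [hx]

lemma shift_sum (g Φ : ℕ → ℝ) (B k : ℕ) (hg : ∀ z, B ≤ z → g z = 0) :
    ∑ z ∈ range B, (if k ≤ z then g z * Φ (z - k) else 0) = ∑ y ∈ range B, g (y + k) * Φ y := by
  have h1 : ∑ z ∈ range (k + B), (if k ≤ z then g z * Φ (z - k) else 0)
      = ∑ y ∈ range B, g (y + k) * Φ y := by
    rw [sum_range_add]
    rw [sum_eq_zero, zero_add]
    · exact sum_congr rfl fun y _ => by simp [add_comm]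
    · intro z hz
      rw [if_neg]
      simpa using hz
  rw [← h1, Nat.add_comm, sum_range_add]
  rw [left_eq_add]
  exact sum_eq_zero fun y _ => by simp [hg (B + y) (by omega)]

/-- Decomposition of the walk started at `0` according to its first upcrossing of `0`. -/
lemma decomp (hM : 0 < M) (F : ℕ → ℤ → ℝ)
    (hF : ∀ r j, F (r + 1) j = ∑ k ∈ range M, q k * F r (j - 1 + k)) (n B : ℕ) (hB : n + 2 ≤ B)
    (t : ℕ) (ht : t ≤ n) :
    q 0 * F n 0 = ∑ z ∈ range B, hitEq q M (t + 1) z * F (n - t) (1 - z)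
      + ∑ s ∈ range t, ∑ z ∈ range B, hitEq q M (s + 1) z *
          ∑ k ∈ range M, (if z < k then q k * F (n - s - 1) ((k : ℤ) - z) else 0) := by
  induction t with
  | zero =>
    simp only [range_zero, sum_empty, add_zero, zero_add, hitEq_one hM]
    rw [sum_eq_single 1]
    · simp
    · intro b _ hb; simp [hb]
    · intro h; simp at h; omega
  | succ t ih =>
    rw [ih (by omega), sum_range_succ]
    rw [add_comm (∑ s ∈ range t, _) (∑ z ∈ range B, _), ← add_assoc]
    congr 1
    have en : n - t = (n - t - 1) + 1 := by omega
    have e1 : ∀ z : ℕ, hitEq q M (t + 1) z * F (n - t) (1 - z)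
        = ∑ k ∈ range M, (if k ≤ z then hitEq q M (t + 1) z *
            (q k * F (n - t - 1) (-((z - k : ℕ) : ℤ))) else 0)
          + hitEq q M (t + 1) z *
          ∑ k ∈ range M, (if z < k then q k * F (n - t - 1) ((k : ℤ) - z) else 0) := by
      intro z
      rw [en, hF, mul_sum, mul_sum, ← sum_add_distrib]
      refine sum_congr rfl fun k _ => ?_
      have : (1 : ℤ) - z - 1 + k = k - z := by ring
      rw [this]
      by_cases hk : k ≤ z
      · rw [if_pos hk, if_neg (by omega)]
        have : -((z - k : ℕ) : ℤ) = k - z := by push_cast [hk]; ring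
        rw [this]; simp
      · rw [if_neg hk, if_pos (by omega)]; simp
    simp only [e1, sum_add_distrib]
    congr 1
    rw [sum_comm]
    have e2 : ∀ k, ∑ z ∈ range B, (if k ≤ z then hitEq q M (t + 1) z *
            (q k * F (n - t - 1) (-((z - k : ℕ) : ℤ))) else 0)
        = ∑ y ∈ range B, hitEq q M (t + 1) (y + k) * (q k * F (n - t - 1) (-(y : ℤ))) := fun k =>
      shift_sum (hitEq q M (t + 1)) (fun y => q k * F (n - t - 1) (-(y : ℤ))) B k
        (fun z hz => hitEq_eq_zero _ _ (by omega))
    simp only [e2]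
    rw [sum_comm]
    have e3 : ∑ z ∈ range B, hitEq q M (t + 1 + 1) z * F (n - (t + 1)) (1 - z)
        = ∑ z ∈ range (B + 1), hitEq q M (t + 1 + 1) z * F (n - (t + 1)) (1 - z) := by
      rw [sum_range_succ, hitEq_eq_zero _ B (by omega)]; simp
    rw [e3, sum_range_succ']
    simp only [hitEq]
    simp only [zero_mul, add_zero]
    refine sum_congr rfl fun y _ => ?_
    rw [sum_mul]
    refine sum_congr rfl fun k _ => ?_
    have : (1 : ℤ) - ((y + 1 : ℕ) : ℤ) = -(y : ℤ) := by push_cast; ring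
    rw [this, Nat.sub_sub]; ring

lemma nonposAt_nonneg (hq : ∀ k, 0 ≤ q k) (r : ℕ) : ∀ j, 0 ≤ nonposAt q M r j := by
  induction r with
  | zero => intro x; simp only [nonposAt]; split_ifs <;> norm_num
  | succ r ih => intro x; exact sum_nonneg fun k _ => mul_nonneg (hq k) (ih _)

lemma nonposAt_eq_zero (r : ℕ) : ∀ j : ℤ, (r : ℤ) < j → nonposAt q M r j = 0 := by
  induction r with
  | zero => intro j hj; simp [nonposAt]; simpa using hj
  | succ r ih =>
    intro j hj
    exact sum_eq_zero fun k _ => by rw [ih _ (by push_cast at hj; omega), mul_zero]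

lemma nonposAt_ge (hq : ∀ k, 0 ≤ q k) (C : ℝ) (R : ℕ)
    (hC : ∀ m < R, C ≤ nonposAt q M m 0) (r : ℕ) :
    r ≤ R → ∀ x : ℕ, C * hitLe q M r (x + 1) ≤ nonposAt q M r ((x : ℤ) + 1) := by
  induction r with
  | zero =>
    intro _ x
    have := nonposAt_nonneg (M := M) hq 0 ((x : ℤ) + 1)
    simpa [hitLe] using this
  | succ r ih =>
    intro hr x
    simp only [hitLe, nonposAt, mul_sum]
    refine sum_le_sum fun k _ => ?_
    rw [mul_left_comm]
    refine mul_le_mul_of_nonneg_left ?_ (hq k)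
    rcases h : x + k with _ | y
    · have : (x : ℤ) + 1 - 1 + k = 0 := by omega
      rw [this, hitLe_zero, mul_one]
      exact hC r (by omega)
    · have : (x : ℤ) + 1 - 1 + k = (y : ℤ) + 1 := by omega
      rw [this]
      exact ih (by omega) y

end walk

section walk2

variable {q : ℕ → ℝ} {M : ℕ}

lemma swap_sum (a g : ℕ → ℕ → ℝ) (m B : ℕ) (hB : M ≤ B) (ha : ∀ s, a s 0 = 0) :
    ∑ s ∈ range m, ∑ z ∈ range B, a s z *
        ∑ k ∈ range M, (if z < k then q k * g s (k - z) else 0)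
      = ∑ k ∈ range M, q k * ∑ z ∈ Ico 1 k, ∑ s ∈ range m, a s z * g s (k - z) := by
  have h1 : ∀ s k, k ∈ range M → ∑ z ∈ range B, a s z * (if z < k then q k * g s (k - z) else 0)
      = ∑ z ∈ Ico 1 k, q k * (a s z * g s (k - z)) := by
    intro s k hk
    have hk' : k < M := by simpa using hk
    symm
    have hsub : Ico 1 k ⊆ range B := by
      intro z hz
      simp only [mem_Ico, mem_range] at *
      omega
    rw [← sum_subset hsub]
    · refine sum_congr rfl fun z hz => ?_
      have : z < k := (mem_Ico.1 hz).2
      rw [if_pos this]; ring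
    · intro z _ hz
      simp only [mem_Ico, not_and, not_lt] at hz
      by_cases h0 : z = 0
      · subst h0; rw [ha, zero_mul]
      · rw [if_neg (by have := hz (by omega); omega), mul_zero]
  calc _ = ∑ s ∈ range m, ∑ k ∈ range M, ∑ z ∈ Ico 1 k, q k * (a s z * g s (k - z)) := by
        refine sum_congr rfl fun s _ => ?_
        simp_rw [mul_sum]
        rw [sum_comm]
        exact sum_congr rfl fun k hk => h1 s k hk
    _ = _ := by
        rw [sum_comm]
        refine sum_congr rfl fun k _ => ?_
        rw [sum_comm, mul_sum]
        refine sum_congr rfl fun z _ => ?_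
        rw [mul_sum]

lemma key_lower (hq : ∀ k, 0 ≤ q k) (hM : 0 < M) (h1 : ∑ k ∈ range M, q k = 1) (C : ℝ)
    (m : ℕ) (hC : ∀ r < m, C ≤ nonposAt q M r 0) :
    q 0 - ∑ k ∈ range M, q k * ∑ z ∈ Ico 1 k, hitLe q M m z
      + C * ∑ k ∈ range M, q k * (((k - 1 : ℕ) : ℝ) * hitLe q M m k) ≤ q 0 * nonposAt q M m 0 := by
  have ha : ∀ s, hitEq q M (s + 1) 0 = 0 := fun s => by simp [hitEq]
  have d1 := decomp (q := q) (M := M) hM (fun _ _ => 1) (by intro r j; simp [h1]) m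
    (m + 2 + M) (by omega) m le_rfl
  have d2 := decomp (q := q) (M := M) hM (nonposAt q M) (fun r j => rfl) m
    (m + 2 + M) (by omega) m le_rfl
  have e1 := swap_sum (q := q) (M := M) (fun s z => hitEq q M (s + 1) z) (fun _ _ => 1) m
    (m + 2 + M) (by omega) ha
  have e2 := swap_sum (q := q) (M := M) (fun s z => hitEq q M (s + 1) z)
    (fun s y => hitLe q M (m - s - 1) y) m (m + 2 + M) (by omega) ha
  have f1 : ∑ k ∈ range M, q k * ∑ z ∈ Ico 1 k, ∑ s ∈ range m, hitEq q M (s + 1) z * 1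
      = ∑ k ∈ range M, q k * ∑ z ∈ Ico 1 k, hitLe q M m z := by
    refine sum_congr rfl fun k _ => ?_
    congr 1
    refine sum_congr rfl fun z hz => ?_
    have := hitLe_conv' (q := q) (M := M) m z 0 (by have := (mem_Ico.1 hz).1; omega)
    simpa [hitLe_zero] using this
  have f2 : ∑ k ∈ range M, q k * ∑ z ∈ Ico 1 k, ∑ s ∈ range m,
        hitEq q M (s + 1) z * hitLe q M (m - s - 1) (k - z)
      = ∑ k ∈ range M, q k * (((k - 1 : ℕ) : ℝ) * hitLe q M m k) := by
    refine sum_congr rfl fun k _ => ?_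
    congr 1
    rw [sum_congr rfl (g := fun _ => hitLe q M m k)]
    · simp
    · intro z hz
      obtain ⟨hz1, hz2⟩ := mem_Ico.1 hz
      rw [hitLe_conv' m z (k - z) (by omega)]
      congr 1; omega
  have g1 : ∑ z ∈ range (m + 2 + M), hitEq q M (m + 1) z * nonposAt q M (m - m) (1 - z)
      = ∑ z ∈ range (m + 2 + M), hitEq q M (m + 1) z * 1 := by
    refine sum_congr rfl fun z _ => ?_
    rcases Nat.eq_zero_or_pos z with rfl | hz
    · simp [ha]
    · congr 1
      rw [Nat.sub_self]
      simp only [nonposAt]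
      rw [if_pos (by omega)]
  have g2 : C * ∑ s ∈ range m, ∑ z ∈ range (m + 2 + M), hitEq q M (s + 1) z *
        ∑ k ∈ range M, (if z < k then q k * hitLe q M (m - s - 1) (k - z) else 0)
      ≤ ∑ s ∈ range m, ∑ z ∈ range (m + 2 + M), hitEq q M (s + 1) z *
        ∑ k ∈ range M, (if z < k then q k * nonposAt q M (m - s - 1) ((k : ℤ) - z) else 0) := by
    rw [mul_sum]
    refine sum_le_sum fun s _ => ?_
    rw [mul_sum]
    refine sum_le_sum fun z _ => ?_
    rw [mul_left_comm]
    refine mul_le_mul_of_nonneg_left ?_ (hitEq_nonneg hq _ _)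
    rw [mul_sum]
    refine sum_le_sum fun k _ => ?_
    split_ifs with h
    · rw [mul_left_comm]
      refine mul_le_mul_of_nonneg_left ?_ (hq k)
      have := nonposAt_ge (M := M) hq C m hC (m - s - 1) (by omega) (k - z - 1)
      have hk1 : k - z - 1 + 1 = k - z := by omega
      have hk2 : (((k - z - 1 : ℕ) : ℤ) + 1) = (k : ℤ) - z := by omega
      rwa [hk1, hk2] at this
    · simp
  rw [e2, f2] at g2
  rw [g1] at d2
  simp only [mul_one] at d1 d2 e1 f1
  rw [e1, f1] at d1
  rw [d2]
  linarith

end walk2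

section scalar

lemma geom_aux (b : ℝ) (k : ℕ) (hk : 1 ≤ k) : (1 - b) * ∑ z ∈ Ico 1 k, b ^ z = b - b ^ k := by
  induction k, hk using Nat.le_induction with
  | base => simp
  | succ k hk ih =>
    rw [sum_Ico_succ_top hk, mul_add, ih, pow_succ]
    ring

lemma cc_succ (j : ℕ) :
    (((j + 1 : ℕ) : ℝ) / ((j + 1 : ℕ) + 1)) ^ (j + 1) ≤ ((j : ℝ) / (j + 1)) ^ j := by
  have hj : (0 : ℝ) ≤ j := Nat.cast_nonneg j
  push_cast
  have e : (j : ℝ) / (j + 1) = (1 + -(1 / ((j : ℝ) + 1) ^ 2)) * (((j : ℝ) + 1) / (j + 1 + 1)) := by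
    field_simp
    ring
  rw [e, mul_pow, pow_succ, mul_comm]
  refine mul_le_mul_of_nonneg_right ?_ (by positivity)
  have h1 : 1 / ((j : ℝ) + 1) ^ 2 ≤ 1 := by
    rw [div_le_one (by positivity)]
    nlinarith
  refine le_trans ?_ (one_add_mul_le_pow (by linarith) j)
  rw [div_le_iff₀ (by positivity)]
  have e2 : (1 + (j : ℝ) * -(1 / ((j : ℝ) + 1) ^ 2)) * (j + 1 + 1)
      = (j + 1) + 1 / ((j : ℝ) + 1) ^ 2 := by
    field_simp
    ring
  rw [e2]
  have : 0 ≤ 1 / ((j : ℝ) + 1) ^ 2 := by positivity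
  linarith

lemma cc_anti {j n : ℕ} (h : j ≤ n) :
    ((n : ℝ) / (n + 1)) ^ n ≤ ((j : ℝ) / (j + 1)) ^ j := by
  induction n, h using Nat.le_induction with
  | base => exact le_rfl
  | succ n _ ih => exact (cc_succ n).trans ih

lemma bern (j : ℕ) (hj : 1 ≤ j) (b : ℝ) (hb : 0 ≤ b) :
    ((j : ℝ) / (j + 1)) ^ j * (1 - j + (j + 1) * b) ≤ b ^ j := by
  have hj : (0 : ℝ) < j := by exact_mod_cast hj
  have e : b = ((j : ℝ) / (j + 1)) * (1 + (b * (j + 1) / j - 1)) := by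
    field_simp
    ring
  conv_rhs => rw [e, mul_pow]
  refine mul_le_mul_of_nonneg_left ?_ (by positivity)
  have h0 : 0 ≤ b * (j + 1) / j := by positivity
  refine le_trans (le_of_eq ?_) (one_add_mul_le_pow (by linarith) j)
  field_simp
  ring

lemma aux_pow (b : ℝ) (hb : 0 ≤ b) (hb1 : b ≤ 1) (k : ℕ) :
    (k : ℝ) * (1 - b) * b ^ k ≤ b * (1 - b ^ k) := by
  induction k with
  | zero => simp
  | succ k ih =>
    have hk : 0 ≤ b ^ k := pow_nonneg hb k
    have hk1 : b ^ k ≤ 1 := pow_le_one₀ hb hb1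
    push_cast
    rw [pow_succ]
    nlinarith [mul_nonneg hb (sub_nonneg.2 hb1), mul_le_mul_of_nonneg_left ih hb,
      mul_nonneg (mul_nonneg hb (sub_nonneg.2 hb1)) (sub_nonneg.2 hk1)]

lemma V_nonneg (b : ℝ) (hb : 0 ≤ b) (hb1 : b ≤ 1) (k : ℕ) :
    0 ≤ (1 + b) * (k * (1 - b) - 1 + b ^ k) - (1 - b) * ((k : ℝ) - 1) * (1 - b ^ k) := by
  induction k with
  | zero => simp
  | succ k ih =>
    have h := mul_nonneg (sub_nonneg.2 hb1) (sub_nonneg.2 (aux_pow b hb hb1 k))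
    push_cast
    rw [pow_succ]
    nlinarith

lemma U_nonneg (n : ℕ) (hn : 1 ≤ n) (C : ℝ) (hC0 : 0 ≤ C) (hC : C = ((n : ℝ) / (n + 1)) ^ n)
    (b S : ℝ) (hb : 0 ≤ b) (hb1 : b ≤ 1) (k : ℕ) (hk1 : 1 ≤ k) (hk : k ≤ n + 1)
    (hS : 1 - b ^ k ≤ S) (hS1 : S ≤ 1) :
    0 ≤ b ^ k - 1 + S - C * (1 - b) * ((k : ℝ) - 1) * S + C * (1 + b) * (k * (1 - b) - S) := by
  have u0 := mul_nonneg hC0 (V_nonneg b hb hb1 k)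
  have u1 : 0 ≤ b * (b ^ (k - 1) - C * (2 - k * (1 - b))) := by
    refine mul_nonneg hb (sub_nonneg.2 ?_)
    by_cases hneg : 2 - (k : ℝ) * (1 - b) ≤ 0
    · exact (mul_nonpos_of_nonneg_of_nonpos hC0 hneg).trans (pow_nonneg hb _)
    · push Not at hneg
      obtain ⟨j, rfl⟩ : ∃ j, k = j + 1 := ⟨k - 1, by omega⟩
      rw [Nat.add_sub_cancel]
      rcases Nat.eq_zero_or_pos j with rfl | hj
      · have h2 : C ≤ 1 / 2 := by
          have := cc_anti hn
          rw [← hC] at this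
          norm_num at this
          linarith
        norm_num at *
        nlinarith
      · have hCj : C ≤ ((j : ℝ) / (j + 1)) ^ j := by rw [hC]; exact cc_anti (by omega)
        have h3 := bern j hj b hb
        have h4 := mul_le_mul_of_nonneg_right hCj hneg.le
        refine h4.trans (le_trans (le_of_eq ?_) h3)
        push_cast
        ring
  have ek : b ^ k = b * b ^ (k - 1) := by
    rw [← pow_succ']; congr 1; omega
  by_cases hd : 0 ≤ 1 - C * (1 - b) * ((k : ℝ) - 1) - C * (1 + b)
  · have := mul_nonneg hd (sub_nonneg.2 hS)
    nlinarith
  · push Not at hd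
    have := mul_nonneg (neg_nonneg.2 hd.le) (sub_nonneg.2 hS1)
    nlinarith

end scalar

lemma final_ineq (n : ℕ) (hn : 1 ≤ n) (C : ℝ) (hC : C = ((n : ℝ) / (n + 1)) ^ n)
    (q H : ℕ → ℝ) (hq : ∀ k, 0 ≤ q k) (h1 : ∑ k ∈ range (n + 2), q k = 1)
    (hm : ∑ k ∈ range (n + 2), (k : ℝ) * q k = 1) (hHz : H 0 = 1) (hH1 : ∀ x, H x ≤ 1) (hH0 : ∀ x, 0 ≤ H x)
    (hHp : ∀ x, H x ≤ (∑ k ∈ range (n + 2), q k * H k) ^ x) :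
    C * q 0 ≤ q 0 - ∑ k ∈ range (n + 2), q k * ∑ z ∈ Ico 1 k, H z
      + C * ∑ k ∈ range (n + 2), q k * (((k - 1 : ℕ) : ℝ) * H k) := by
  have hC0 : 0 ≤ C := by rw [hC]; positivity
  set b := ∑ k ∈ range (n + 2), q k * H k with hbdef
  have hb : 0 ≤ b := sum_nonneg fun k _ => mul_nonneg (hq k) (hH0 k)
  have hb1 : b ≤ 1 := by
    rw [← h1]
    exact sum_le_sum fun k _ => mul_le_of_le_one_right (hq k) (hH1 k)
  have hq0 : q 0 = ∑ k ∈ range (n + 2), q k * ((k - 1 : ℕ) : ℝ) := by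
    rw [sum_range_succ'] at h1 hm ⊢
    simp only [Nat.cast_zero, zero_mul, add_zero, Nat.cast_add, Nat.cast_one, add_mul, one_mul,
      sum_add_distrib] at hm
    simp only [Nat.add_sub_cancel, Nat.zero_sub, Nat.cast_zero, mul_zero, add_zero]
    have : ∑ k ∈ range (n + 1), q (k + 1) * (k : ℝ) = ∑ k ∈ range (n + 1), (k : ℝ) * q (k + 1) :=
      sum_congr rfl fun k _ => mul_comm _ _
    linarith
  set D : ℕ → ℝ := fun k => ((k - 1 : ℕ) : ℝ) - ∑ z ∈ Ico 1 k, H z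
    - C * (((k - 1 : ℕ) : ℝ) * (1 - H k)) with hD
  have hsum : q 0 - ∑ k ∈ range (n + 2), q k * ∑ z ∈ Ico 1 k, H z
      + C * ∑ k ∈ range (n + 2), q k * (((k - 1 : ℕ) : ℝ) * H k) - C * q 0
      = ∑ k ∈ range (n + 2), q k * D k := by
    rw [hq0, mul_sum, mul_sum, ← sum_sub_distrib, ← sum_add_distrib, ← sum_sub_distrib]
    refine sum_congr rfl fun k _ => ?_
    simp only [hD]
    ring
  suffices 0 ≤ ∑ k ∈ range (n + 2), q k * D k by linarith
  rcases hb1.eq_or_lt with hbe | hblt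
  · have hz : ∑ k ∈ range (n + 2), q k * (1 - H k) = 0 := by
      simp only [mul_sub, mul_one, sum_sub_distrib, h1]
      rw [← hbdef, hbe, sub_self]
    rw [sum_eq_zero_iff_of_nonneg
      (fun k _ => mul_nonneg (hq k) (sub_nonneg.2 (hH1 k)))] at hz
    refine sum_nonneg fun k hk => ?_
    have e : q k * D k = q k * (((k - 1 : ℕ) : ℝ) - ∑ z ∈ Ico 1 k, H z)
        - C * ((k - 1 : ℕ) : ℝ) * (q k * (1 - H k)) := by
      simp only [hD]; ring
    rw [e, hz k hk, mul_zero, sub_zero]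
    refine mul_nonneg (hq k) (sub_nonneg.2 ?_)
    calc ∑ z ∈ Ico 1 k, H z ≤ ∑ z ∈ Ico 1 k, (1 : ℝ) := sum_le_sum fun z _ => hH1 z
      _ = _ := by simp
  · have hpt : ∀ k ∈ range (n + 2),
        (1 - C * (1 + b)) * (q k * (k * (1 - b) - (1 - H k))) ≤ (1 - b) * (q k * D k) := by
      intro k hk
      have hk' : k ≤ n + 1 := by have := mem_range.1 hk; omega
      have : (1 - C * (1 + b)) * (k * (1 - b) - (1 - H k)) ≤ (1 - b) * D k := by
        rcases Nat.eq_zero_or_pos k with rfl | hkpos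
        · simp [hD, hHz]
        · have hU := U_nonneg n hn C hC0 hC b (1 - H k) hb hb1 k hkpos hk'
            (by linarith [hHp k]) (by linarith [hH0 k])
          have hg : (1 - b) * ∑ z ∈ Ico 1 k, H z ≤ b - b ^ k := by
            have h5 : ∑ z ∈ Ico 1 k, H z ≤ ∑ z ∈ Ico 1 k, b ^ z := sum_le_sum fun z _ => hHp z
            have h6 : (1 - b) * ∑ z ∈ Ico 1 k, b ^ z = b - b ^ k := geom_aux b k hkpos
            rw [← h6]
            exact mul_le_mul_of_nonneg_left h5 (by linarith)
          have hc : ((k - 1 : ℕ) : ℝ) = (k : ℝ) - 1 := by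
            rw [Nat.cast_sub hkpos]; simp
          simp only [hD, hc]
          nlinarith
      nlinarith [mul_le_mul_of_nonneg_left this (hq k)]
    have hs := sum_le_sum hpt
    rw [← mul_sum, ← mul_sum] at hs
    have hz : ∑ k ∈ range (n + 2), q k * ((k : ℝ) * (1 - b) - (1 - H k)) = 0 := by
      have : ∀ k ∈ range (n + 2), q k * ((k : ℝ) * (1 - b) - (1 - H k))
          = (1 - b) * (k * q k) - q k + q k * H k := fun k _ => by ring
      rw [sum_congr rfl this, sum_add_distrib, sum_sub_distrib, ← mul_sum, hm, h1, ← hbdef]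
      ring
    rw [hz, mul_zero] at hs
    by_contra hneg
    push Not at hneg
    nlinarith

lemma nonposAt_of_zero {q : ℕ → ℝ} {M : ℕ} (h1 : ∑ k ∈ range M, q k = 1)
    (hz : ∀ k ∈ range M, k ≠ 1 → q k = 0) (m : ℕ) : nonposAt q M m 0 = 1 := by
  induction m with
  | zero => simp [nonposAt]
  | succ m ih =>
    simp only [nonposAt]
    rw [← h1]
    refine sum_congr rfl fun k hk => ?_
    by_cases h : k = 1
    · subst h
      simp [ih]
    · rw [hz k hk h, zero_mul]

lemma walk_bound (n : ℕ) (hn : 1 ≤ n) (C : ℝ) (hC : C = ((n : ℝ) / (n + 1)) ^ n)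
    (q : ℕ → ℝ) (hq : ∀ k, 0 ≤ q k) (h1 : ∑ k ∈ range (n + 2), q k = 1)
    (hm : ∑ k ∈ range (n + 2), (k : ℝ) * q k = 1) (m : ℕ) : C ≤ nonposAt q (n + 2) m 0 := by
  have hC1 : C ≤ 1 := by
    rw [hC]
    refine pow_le_one₀ (by positivity) ?_
    rw [div_le_one (by positivity)]
    linarith
  induction m using Nat.strong_induction_on with
  | _ m ih =>
  rcases (hq 0).eq_or_lt with h0 | h0
  · rw [nonposAt_of_zero h1]
    · exact hC1
    · have hs : ∑ k ∈ range (n + 2), ((k : ℝ) - 1) * q k = 0 := by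
        simp only [sub_mul, one_mul, sum_sub_distrib, h1, hm, sub_self]
      have hnn : ∀ k ∈ range (n + 2), 0 ≤ ((k : ℝ) - 1) * q k := by
        intro k _
        rcases Nat.eq_zero_or_pos k with rfl | hk
        · simp [← h0]
        · have : (1 : ℝ) ≤ k := by exact_mod_cast hk
          exact mul_nonneg (by linarith) (hq k)
      rw [sum_eq_zero_iff_of_nonneg hnn] at hs
      intro k hk hk1
      rcases mul_eq_zero.1 (hs k hk) with h | h
      · exact absurd (by exact_mod_cast sub_eq_zero.1 h) hk1
      · exact h
  · have hk := key_lower hq (by omega) h1 C m ih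
    have hf := final_ineq n hn C hC q (hitLe q (n + 2) m) hq h1 hm (hitLe_zero m)
      (hitLe_le_one hq h1 m) (hitLe_nonneg hq m)
      (fun x => (hitLe_le_pow hq m x).trans
        (pow_le_pow_left₀ (hitLe_nonneg hq m 1) (hitLe_one_le hq m) x))
    have := hf.trans hk
    rw [mul_comm C] at this
    exact le_of_mul_le_mul_left this h0

lemma link (n : ℕ) (p q : ℕ → ℝ) (hp : ∀ k, 0 ≤ p k) (hq : ∀ k, 0 ≤ q k)
    (hqp : ∀ k, k ≤ n → q k ≤ p k)
    (m : ℕ) : ∀ z : ℤ, (m : ℤ) - z ≤ n → nonposAt q (n + 2) m z ≤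
      ∑ f : Fin m → Fin (n + 1), if (∑ i, ((f i : ℕ) : ℤ)) ≤ (m : ℤ) - z then
        ∏ i, p (f i) else 0 := by
  induction m with
  | zero => intro z _; simp [nonposAt]
  | succ m ih =>
    intro z hz
    simp only [nonposAt]
    rw [sum_range_succ, nonposAt_eq_zero m _ (by push_cast at hz ⊢; omega), mul_zero, add_zero]
    rw [← (Fin.consEquiv (fun _ : Fin (m + 1) => Fin (n + 1))).sum_comp]
    rw [Fintype.sum_prod_type, ← Fin.sum_univ_eq_sum_range
      (fun k => q k * nonposAt q (n + 2) m (z - 1 + k))]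
    refine sum_le_sum fun k _ => ?_
    have hk : (k : ℕ) ≤ n := by omega
    calc q k * nonposAt q (n + 2) m (z - 1 + (k : ℕ))
        ≤ p k * ∑ f : Fin m → Fin (n + 1),
          if (∑ i, ((f i : ℕ) : ℤ)) ≤ (m : ℤ) - (z - 1 + (k : ℕ)) then ∏ i, p (f i) else 0 := by
          refine mul_le_mul (hqp k hk) (ih _ (by push_cast at hz; omega))
            (nonposAt_nonneg hq _ _) (hp _)
      _ = _ := by
          rw [mul_sum]
          refine sum_congr rfl fun f _ => ?_
          simp only [Fin.consEquiv, Equiv.coe_fn_mk, Fin.sum_univ_succ, Fin.prod_univ_succ,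
            Fin.cons_zero, Fin.cons_succ]
          rw [mul_ite, mul_zero]
          refine if_congr ?_ rfl rfl
          push_cast
          constructor <;> intro h <;> linarith

lemma trunc (n : ℕ) (p : ℕ → ℝ) (hp : IsDist p) : ∃ q : ℕ → ℝ, (∀ k, 0 ≤ q k) ∧
    (∀ k, k ≤ n → q k ≤ p k) ∧ ∑ k ∈ range (n + 2), q k = 1 ∧
    ∑ k ∈ range (n + 2), (k : ℝ) * q k = 1 := by
  obtain ⟨hp0, hs1, hs2⟩ := hp
  have hN : (0 : ℝ) < (n : ℝ) + 1 := by positivity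
  set A := ∑ k ∈ range n, p (k + 1) with hA
  set E := ∑ k ∈ range n, ((k + 1 : ℕ) : ℝ) * p (k + 1) with hE
  have hE1 : E ≤ 1 := by
    have := sum_le_hasSum (range (n + 1)) (fun i _ => mul_nonneg (Nat.cast_nonneg i) (hp0 i)) hs2
    rw [sum_range_succ'] at this
    simpa [hE] using this
  have hAE : A ≤ E := by
    refine sum_le_sum fun k _ => le_mul_of_one_le_left (hp0 _) ?_
    exact_mod_cast Nat.succ_le_succ (Nat.zero_le k)
  set t := (1 - E) / ((n : ℝ) + 1) with ht
  have htE : ((n : ℝ) + 1) * t = 1 - E := by rw [ht]; field_simp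
  have ht0 : 0 ≤ t := div_nonneg (by linarith) hN.le
  have hn0 : (0 : ℝ) ≤ n := Nat.cast_nonneg n
  have hq0 : 0 ≤ 1 - A - t := by nlinarith
  have hq0p : 1 - A - t ≤ p 0 := by
    have hh := hs2.sub (hs1.mul_left ((n : ℝ) + 1))
    have := sum_le_hasSum (range (n + 1)) (fun i hi => ?_) hh
    · rw [sum_range_succ', sum_sub_distrib, ← mul_sum, ← hE, ← hA] at this
      simp only [Nat.cast_zero, zero_mul, zero_sub, mul_one] at this
      have : 0 ≤ ((n : ℝ) + 1) * (p 0 - (1 - A - t)) := by nlinarith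
      by_contra hneg
      push Not at hneg
      nlinarith
    · have hi : n + 1 ≤ i := by simpa using hi
      have hi : (n : ℝ) + 1 ≤ i := by exact_mod_cast hi
      nlinarith [mul_le_mul_of_nonneg_right hi (hp0 i)]
  refine ⟨fun k => if k = 0 then 1 - A - t else if k ≤ n then p k else t, ?_, ?_, ?_, ?_⟩
  · intro k
    dsimp only
    split_ifs
    · exact hq0
    · exact hp0 k
    · exact ht0
  · intro k hk
    dsimp only
    split_ifs with h
    · rw [h]; exact hq0p
    · exact le_rfl
  · rw [sum_range_succ, sum_range_succ']
    have : ∀ k ∈ range n, (if k + 1 = 0 then 1 - A - t else if k + 1 ≤ n then p (k + 1) else t)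
        = p (k + 1) := by
      intro k hk
      have := mem_range.1 hk
      rw [if_neg (by omega), if_pos (by omega)]
    rw [sum_congr rfl this, ← hA]
    simp
    ring
  · rw [sum_range_succ, sum_range_succ']
    have : ∀ k ∈ range n, ((k + 1 : ℕ) : ℝ) *
        (if k + 1 = 0 then 1 - A - t else if k + 1 ≤ n then p (k + 1) else t)
        = ((k + 1 : ℕ) : ℝ) * p (k + 1) := by
      intro k hk
      have := mem_range.1 hk
      rw [if_neg (by omega), if_pos (by omega)]
    rw [sum_congr rfl this, ← hE]
    simp
    linarith

theorem stmt13 (n : ℕ) (hn : 2 ≤ n) :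
    probLe n (fun _ => fun x => if x = 0 then 1 - 1 / ((n : ℝ) + 1)
                                else if x = n + 1 then 1 / ((n : ℝ) + 1) else 0) =
      (1 - 1 / ((n : ℝ) + 1)) ^ n ∧
    (∀ p : ℕ → ℝ, IsDist p →
      (1 - 1 / ((n : ℝ) + 1)) ^ n ≤ probLe n (fun _ => p)) := by
  constructor
  · unfold probLe
    rw [Finset.sum_eq_single (fun _ => 0)]
    · simp
    · intro f _ hf
      obtain ⟨i, hi⟩ : ∃ i, f i ≠ 0 := by
        by_contra h
        push Not at h
        exact hf (funext h)
      refine Finset.prod_eq_zero (Finset.mem_univ i) ?_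
      have h1 : (f i : ℕ) ≠ 0 := fun h => hi (Fin.ext h)
      have h2 : (f i : ℕ) ≠ n + 1 := by have := (f i).2; omega
      dsimp only
      rw [if_neg h1, if_neg h2]
    · intro h
      simp at h
  · intro p hp
    obtain ⟨q, hq, hqp, h1, hm⟩ := trunc n p hp
    have hw := walk_bound n (by omega) _ rfl q hq h1 hm n
    have hl := link n p q hp.1 hq hqp n 0 (by simp)
    have e : (1 - 1 / ((n : ℝ) + 1)) = (n : ℝ) / (n + 1) := by
      have : (n : ℝ) + 1 ≠ 0 := by positivity
      field_simp
      ring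
    rw [e]
    refine hw.trans (hl.trans (le_of_eq ?_))
    unfold probLe
    rw [Finset.sum_filter]
    refine Finset.sum_congr rfl fun f _ => if_congr ?_ rfl rfl
    rw [sub_zero]
    norm_cast
end

section
/- For integers 2 ≤ j ≤ n+1 with n ≥ 2, ∑_{k: kj ≤ n} C(n,k) (1/j)^k (1 - 1/j)^{n-k} ≥ (1 - 1/(n+1))^n, with equality iff j = n+1. -/
/-- Binomial lower tail. -/
noncomputable def binTail (n M : ℕ) (t : ℝ) : ℝ :=
  ∑ k ∈ Finset.range (M + 1), (n.choose k : ℝ) * t ^ k * (1 - t) ^ (n - k)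

lemma binTail_hasDerivAt (n M : ℕ) (t : ℝ) :
    HasDerivAt (binTail n M)
      (-(((n - M : ℕ) : ℝ) * (n.choose M : ℝ) * t ^ M * (1 - t) ^ (n - M - 1))) t := by
  have hs : HasDerivAt (fun t : ℝ => 1 - t) (-1) t := by
    simpa using (hasDerivAt_id t).const_sub 1
  induction M with
  | zero =>
    have h := hs.pow n
    have e : binTail n 0 = (fun t : ℝ => 1 - t) ^ n := by
      funext x; simp [binTail]
    rw [e]
    refine h.congr_deriv ?_
    simp
  | succ M ih =>
    have e : binTail n (M + 1) = fun x => binTail n M x +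
        (n.choose (M + 1) : ℝ) * x ^ (M + 1) * (1 - x) ^ (n - (M + 1)) := by
      funext x; simp only [binTail]; rw [Finset.sum_range_succ _ (M + 1)]
    rw [e]
    have h2 := ((hasDerivAt_pow (M + 1) t).const_mul (n.choose (M + 1) : ℝ)).mul
      (hs.pow (n - (M + 1)))
    have h3 := ih.add h2
    have hc : (n.choose (M + 1) : ℝ) * ((M : ℝ) + 1) = (n.choose M : ℝ) * ((n - M : ℕ) : ℝ) := by
      exact_mod_cast Nat.choose_succ_right_eq n M
    refine h3.congr_deriv ?_
    simp only [Pi.pow_apply, Nat.add_sub_cancel, Nat.cast_add, Nat.cast_one]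
    rw [Nat.sub_sub n M 1]
    linear_combination t ^ M * (1 - t) ^ (n - (M + 1)) * hc

lemma binTail_antitone (n M : ℕ) {x y : ℝ} (hx : 0 ≤ x) (hxy : x ≤ y) (hy : y ≤ 1) :
    binTail n M y ≤ binTail n M x := by
  have h : AntitoneOn (binTail n M) (Set.Icc 0 1) := by
    apply antitoneOn_of_deriv_nonpos (convex_Icc 0 1)
    · exact fun t _ => (binTail_hasDerivAt n M t).continuousAt.continuousWithinAt
    · exact fun t _ => (binTail_hasDerivAt n M t).differentiableAt.differentiableWithinAt
    · intro t ht
      rw [interior_Icc] at ht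
      rw [(binTail_hasDerivAt n M t).deriv]
      have h0 := ht.1.le
      have h1 : 0 ≤ 1 - t := by linarith [ht.2]
      have : 0 ≤ ((n - M : ℕ) : ℝ) * (n.choose M : ℝ) * t ^ M * (1 - t) ^ (n - M - 1) := by
        positivity
      linarith
  exact h ⟨hx, hxy.trans hy⟩ ⟨hx.trans hxy, hy⟩ hxy

/-- `t^M (1-t)^b` is maximal at `M/(M+b)`. -/
lemma key_max (M b : ℕ) (hM : 0 < M) (hb : 0 < b) {t : ℝ} (ht0 : 0 < t) (ht1 : t < 1)
    (hne : t ≠ (M : ℝ) / (M + b)) :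
    t ^ M * (1 - t) ^ b < ((M : ℝ) / (M + b)) ^ M * ((b : ℝ) / (M + b)) ^ b := by
  have hM' : (0 : ℝ) < M := by exact_mod_cast hM
  have hb' : (0 : ℝ) < b := by exact_mod_cast hb
  have hN : (0 : ℝ) < M + b := by positivity
  set s : ℝ := t * (M + b) - M with hs
  have hs0 : s ≠ 0 := by
    intro h; apply hne; rw [eq_div_iff hN.ne']; linarith
  have e1 : t = (M : ℝ) / (M + b) * (s / M + 1) := by
    rw [hs]; field_simp; ring
  have e2 : 1 - t = (b : ℝ) / (M + b) * (-s / b + 1) := by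
    rw [hs]; field_simp; ring
  have p1 : 0 < s / M + 1 := by
    have : 0 < (M : ℝ) / (M + b) := by positivity
    rw [e1] at ht0; exact (pos_iff_pos_of_mul_pos ht0).1 this
  have p2 : 0 < -s / b + 1 := by
    have h : 0 < 1 - t := by linarith
    have : 0 < (b : ℝ) / (M + b) := by positivity
    rw [e2] at h; exact (pos_iff_pos_of_mul_pos h).1 this
  have l1 : (s / M + 1) ^ M < Real.exp s := by
    have := pow_lt_pow_left₀ (Real.add_one_lt_exp (x := s / M) (by positivity)) p1.le hM.ne'
    rwa [← Real.exp_nat_mul, mul_div_cancel₀ _ hM'.ne'] at this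
  have l2 : (-s / b + 1) ^ b < Real.exp (-s) := by
    have := pow_lt_pow_left₀ (Real.add_one_lt_exp (x := -s / b)
      (div_ne_zero (neg_ne_zero.2 hs0) hb'.ne')) p2.le hb.ne'
    rwa [← Real.exp_nat_mul, mul_div_cancel₀ _ hb'.ne'] at this
  have l3 : (s / M + 1) ^ M * (-s / b + 1) ^ b < 1 := by
    have := mul_lt_mul'' l1 l2 (by positivity) (by positivity)
    rwa [← Real.exp_add, add_neg_cancel, Real.exp_zero] at this
  rw [e2]
  nth_rewrite 1 [e1]
  rw [mul_pow, mul_pow]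
  have hP : 0 < ((M : ℝ) / (M + b)) ^ M * ((b : ℝ) / (M + b)) ^ b := by positivity
  nlinarith [mul_lt_mul_of_pos_left l3 hP]

lemma binTail_step (m d : ℕ) :
    binTail (m + d + 2) m (((m : ℝ) + 1) / (m + d + 3)) <
      binTail (m + d + 2) (m + 1) (((m : ℝ) + 2) / (m + d + 3)) := by
  set n := m + d + 2 with hn
  set p : ℝ := ((m : ℝ) + 1) / (m + d + 3) with hp
  set q : ℝ := ((d : ℝ) + 2) / (m + d + 3) with hq
  set p' : ℝ := ((m : ℝ) + 2) / (m + d + 3) with hp'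
  have hN : (0 : ℝ) < m + d + 3 := by positivity
  have hpp : p < p' := by rw [hp, hp']; gcongr; linarith
  have hp0 : 0 < p := by positivity
  have hp1 : p' < 1 := by rw [hp', div_lt_one hN]; linarith [(Nat.cast_nonneg d : (0:ℝ) ≤ d)]
  have hC : (0 : ℝ) < (n.choose (m + 1) : ℝ) := by
    exact_mod_cast Nat.choose_pos (by omega)
  set A : ℝ := ((d : ℝ) + 1) * (n.choose (m + 1) : ℝ) * (p ^ (m + 1) * q ^ (d + 2)) with hA
  have hder : ∀ t : ℝ, t < 1 → HasDerivAt (fun t => binTail n (m + 1) t + A * (1 - t)⁻¹)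
      (-(((d : ℝ) + 1) * (n.choose (m + 1) : ℝ) * t ^ (m + 1) * (1 - t) ^ d)
        + A * (1 / (1 - t) ^ 2)) t := by
    intro t ht
    have h1 := binTail_hasDerivAt n (m + 1) t
    have e1 : n - (m + 1) = d + 1 := by omega
    rw [e1, Nat.add_sub_cancel] at h1
    have hs : HasDerivAt (fun t : ℝ => 1 - t) (-1) t := by
      simpa using (hasDerivAt_id t).const_sub 1
    have h2 := (hs.inv (by linarith : (1 - t) ≠ 0)).const_mul A
    refine (h1.add h2).congr_deriv ?_
    push_cast; ring
  have hmono : StrictMonoOn (fun t => binTail n (m + 1) t + A * (1 - t)⁻¹) (Set.Icc p p') := by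
    apply strictMonoOn_of_deriv_pos (convex_Icc p p')
    · exact fun t ht => (hder t (ht.2.trans_lt hp1)).continuousAt.continuousWithinAt
    · intro t ht
      rw [interior_Icc] at ht
      have ht1 : t < 1 := ht.2.trans hp1
      rw [(hder t ht1).deriv]
      have hk := key_max (m + 1) (d + 2) (by omega) (by omega) (hp0.trans ht.1) ht1 (by
        have : ((m + 1 : ℕ) : ℝ) / ((m + 1 : ℕ) + (d + 2 : ℕ)) = p := by
          rw [hp]; push_cast; congr 1; ring
        rw [this]; exact ht.1.ne')
      have e1 : ((m + 1 : ℕ) : ℝ) / ((m + 1 : ℕ) + (d + 2 : ℕ)) = p := by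
        rw [hp]; push_cast; congr 1; ring
      have e2 : ((d + 2 : ℕ) : ℝ) / ((m + 1 : ℕ) + (d + 2 : ℕ)) = q := by
        rw [hq]; push_cast; congr 1; ring
      rw [e1, e2] at hk
      have hu : 0 < 1 - t := by linarith
      have hB : (0 : ℝ) < ((d : ℝ) + 1) * (n.choose (m + 1) : ℝ) := by positivity
      have e3 : -(((d : ℝ) + 1) * (n.choose (m + 1) : ℝ) * t ^ (m + 1) * (1 - t) ^ d)
        + A * (1 / (1 - t) ^ 2) = ((d : ℝ) + 1) * (n.choose (m + 1) : ℝ) *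
          (p ^ (m + 1) * q ^ (d + 2) - t ^ (m + 1) * (1 - t) ^ (d + 2)) / (1 - t) ^ 2 := by
        rw [hA, pow_add (1 - t) d 2]; field_simp; ring
      rw [e3]
      exact div_pos (mul_pos hB (by linarith)) (by positivity)
  have hlt := hmono ⟨le_rfl, hpp.le⟩ ⟨hpp.le, le_rfl⟩ hpp
  simp only at hlt
  have e4 : binTail n (m + 1) p = binTail n m p +
      (n.choose (m + 1) : ℝ) * p ^ (m + 1) * q ^ (d + 1) := by
    have e5 : n - (m + 1) = d + 1 := by omega
    have e6 : 1 - p = q := by rw [hp, hq]; field_simp; ring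
    simp only [binTail]; rw [Finset.sum_range_succ _ (m + 1), e5, e6]
  have e7 : A * (1 - p')⁻¹ - A * (1 - p)⁻¹ =
      (n.choose (m + 1) : ℝ) * p ^ (m + 1) * q ^ (d + 1) := by
    have f1 : 1 - p = ((d : ℝ) + 2) / (m + d + 3) := by rw [hp]; field_simp; ring
    have f2 : 1 - p' = ((d : ℝ) + 1) / (m + d + 3) := by rw [hp']; field_simp; ring
    have f3 : ((d : ℝ) + 1) * q * ((1 - p')⁻¹ - (1 - p)⁻¹) = 1 := by
      rw [f1, f2, hq]; field_simp; ring
    rw [hA]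
    linear_combination (n.choose (m + 1) : ℝ) * p ^ (m + 1) * q ^ (d + 1) * f3
  linarith

lemma binTail_lt (n m : ℕ) (hm : m + 1 < n) :
    binTail n 0 (1 / ((n : ℝ) + 1)) < binTail n (m + 1) (((m : ℝ) + 2) / (n + 1)) := by
  have step : ∀ m, m + 1 < n → binTail n m (((m : ℝ) + 1) / (n + 1)) <
      binTail n (m + 1) (((m : ℝ) + 2) / (n + 1)) := by
    intro m hm
    obtain ⟨d, rfl⟩ := Nat.exists_eq_add_of_le hm
    have h := binTail_step m d
    have e : ((m + 1 + 1 + d : ℕ) : ℝ) + 1 = m + d + 3 := by push_cast; ring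
    have e' : m + 1 + 1 + d = m + d + 2 := by omega
    simp only [Nat.succ_eq_add_one] at *
    rw [e, e']; exact h
  induction m with
  | zero => simpa using step 0 hm
  | succ m ih =>
    refine (ih (by omega)).trans ?_
    have := step (m + 1) hm
    push_cast at this ⊢
    have e : (m : ℝ) + 1 + 1 = m + 2 := by ring
    rw [e] at this
    exact this

theorem stmt14 (n j : ℕ) (hn : 2 ≤ n) (hj : 2 ≤ j) (hjn : j ≤ n + 1) :
    (1 - 1 / ((n : ℝ) + 1)) ^ n ≤
      ∑ k ∈ (Finset.range (n + 1)).filter (fun k => k * j ≤ n),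
        (n.choose k : ℝ) * (1 / (j : ℝ)) ^ k * (1 - 1 / (j : ℝ)) ^ (n - k) ∧
    ((∑ k ∈ (Finset.range (n + 1)).filter (fun k => k * j ≤ n),
        (n.choose k : ℝ) * (1 / (j : ℝ)) ^ k * (1 - 1 / (j : ℝ)) ^ (n - k) =
      (1 - 1 / ((n : ℝ) + 1)) ^ n) ↔ j = n + 1) := by
  have hset : (Finset.range (n + 1)).filter (fun k => k * j ≤ n) = Finset.range (n / j + 1) := by
    ext k
    simp only [Finset.mem_filter, Finset.mem_range, Nat.lt_succ_iff]
    rw [Nat.le_div_iff_mul_le (by omega)]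
    constructor
    · exact fun h => h.2
    · exact fun h => ⟨by nlinarith, h⟩
  rw [hset]
  change _ ≤ binTail n (n / j) (1 / (j : ℝ)) ∧ (binTail n (n / j) (1 / (j : ℝ)) = _ ↔ _)
  have h0 : binTail n 0 (1 / ((n : ℝ) + 1)) = (1 - 1 / ((n : ℝ) + 1)) ^ n := by simp [binTail]
  rw [← h0]
  rcases Nat.lt_or_ge n j with h | h
  · have hj' : j = n + 1 := by omega
    subst hj'
    rw [Nat.div_eq_of_lt h]
    push_cast
    simp
  · have hm1 : 1 ≤ n / j := (Nat.one_le_div_iff (by omega)).2 h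
    obtain ⟨m, hm⟩ := Nat.exists_eq_add_of_le' hm1
    have hm2 : (m + 1) * j ≤ n := by rw [← hm]; exact Nat.div_mul_le_self n j
    have hm3 : n + 1 ≤ (m + 2) * j := by
      have h1 := Nat.div_add_mod n j
      have h2 := Nat.mod_lt n (show 0 < j by omega)
      rw [hm] at h1
      nlinarith
    have hmn : m + 1 < n := by nlinarith
    have hlt := binTail_lt n m hmn
    have hjp : (0 : ℝ) < j := by exact_mod_cast (by omega : 0 < j)
    have hle : binTail n (m + 1) (((m : ℝ) + 2) / (n + 1)) ≤ binTail n (m + 1) (1 / (j : ℝ)) := by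
      apply binTail_antitone
      · positivity
      · rw [div_le_div_iff₀ hjp (by positivity)]
        have : ((n + 1 : ℕ) : ℝ) ≤ ((m + 2) * j : ℕ) := by exact_mod_cast hm3
        push_cast at this
        linarith
      · rw [div_le_one (by positivity)]
        have : ((m + 2 : ℕ) : ℝ) ≤ (n : ℕ) := by exact_mod_cast hmn
        push_cast at this
        linarith
    rw [hm]
    have hfin := hlt.trans_le hle
    exact ⟨hfin.le, ⟨fun e => absurd e hfin.ne', fun e => by omega⟩⟩
end
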